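/- Let s ≥ 0 and k ≥ 1. For every continuously differentiable function φ : ℝ³ → ℝ with support contained in B(k), one has ∫_{ℝ³} (1+k−|x|)^{s} φ(x)²/|x|² dx ≤ 4 ∫_{ℝ³} (1+k−|x|)^{s} ( ∂_r φ(x) + φ(x)/|x| )² dx. -/

import Mathlib

open MeasureTheory Metric

/-- A function whose weighted integral along every ray from the origin is nonnegative has a
nonnegative integral. -/
theorem integral_nonneg_of_forall_ray {E : Type*} [NormedAddCommGroup E] [NormedSpace ℝ E]
    [MeasurableSpace E] [BorelSpace E] [FiniteDimensional ℝ E] [Nontrivial E] (μ : Measure E)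
    [μ.IsAddHaarMeasure] {f : E → ℝ}
    (h : ∀ v : E, ‖v‖ = 1 →
      0 ≤ ∫ r in Set.Ioi (0 : ℝ), r ^ (Module.finrank ℝ E - 1) * f (r • v)) :
    0 ≤ ∫ x, f x ∂μ := by
  have hpolar : ∫ x, f x ∂μ = ∫ p : sphere (0 : E) 1 × Set.Ioi (0 : ℝ), f (p.2.1 • p.1.1)
      ∂μ.toSphere.prod (.volumeIoiPow (Module.finrank ℝ E - 1)) := by
    calc ∫ x, f x ∂μ = ∫ x : ({0}ᶜ : Set E), f x.1 ∂(μ.comap (↑)) := by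
          rw [integral_subtype_comap (measurableSet_singleton _).compl f,
            restrict_compl_singleton]
      _ = _ := by
          rw [← μ.measurePreserving_homeomorphUnitSphereProd.integral_comp
            (Homeomorph.measurableEmbedding _)]
          refine integral_congr_ae (.of_forall fun x ↦ ?_)
          have hx : ‖x.1‖ ≠ 0 := norm_ne_zero_iff.2 x.2
          simp [smul_smul, hx]
  rw [hpolar]
  by_cases hf : Integrable (fun p : sphere (0 : E) 1 × Set.Ioi (0 : ℝ) ↦ f (p.2.1 • p.1.1))
      (μ.toSphere.prod (.volumeIoiPow (Module.finrank ℝ E - 1)))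
  · rw [integral_prod _ hf]
    refine integral_nonneg fun v ↦ (h v.1 (by simp)).trans_eq ?_
    simp only [Measure.volumeIoiPow, ENNReal.ofReal]
    rw [integral_withDensity_eq_integral_smul
        ((measurable_subtype_coe.pow_const _).real_toNNReal),
      integral_subtype_comap measurableSet_Ioi
        fun a ↦ Real.toNNReal (a ^ (Module.finrank ℝ E - 1)) • f (a • v.1)]
    refine setIntegral_congr_fun measurableSet_Ioi fun r hr ↦ ?_
    simp only [NNReal.smul_def, Real.coe_toNNReal _ (pow_nonneg (Set.mem_Ioi.1 hr).le _),
      smul_eq_mul]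
  · rw [integral_undef hf]

/-- The weighted one-dimensional Hardy inequality for `r ↦ r * u r`, with weight
`(1 + k - r) ^ s`. -/
theorem weighted_hardy_interval {s k : ℝ} (hs : 0 ≤ s) (hk : 0 ≤ k) {u u' : ℝ → ℝ}
    (hu : ∀ r, HasDerivAt u (u' r) r) (hu' : Continuous u') (huk : u k = 0) :
    0 ≤ ∫ r in (0 : ℝ)..k, (1 + k - r) ^ s * (4 * (u r + r * u' r) ^ 2 - u r ^ 2) := by
  have hcu : Continuous u := continuous_iff_continuousAt.2 fun r ↦ (hu r).continuousAt
  have hw : ContinuousOn (fun r : ℝ ↦ (1 + k - r) ^ s) (Set.Icc 0 k) :=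
    ContinuousOn.rpow_const (by fun_prop) fun r hr ↦ .inl (by linarith [hr.2])
  have key := intervalIntegral.sub_le_integral_of_hasDeriv_right_of_le
    (g := fun r ↦ (1 + k - r) ^ s * (2 * (r * u r ^ 2)))
    (φ := fun r ↦ (1 + k - r) ^ s * (4 * (u r + r * u' r) ^ 2 - u r ^ 2)) hk
    (hw.mul (by fun_prop))
    (fun r hr ↦ ((((hasDerivAt_id r).const_sub (1 + k)).rpow_const (p := s)
      (.inl (by simp only [id]; linarith [hr.2]))).mul
      (((hasDerivAt_id r).mul ((hu r).pow 2)).const_mul 2)).hasDerivWithinAt)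
    ((hw.mul (by fun_prop)).integrableOn_Icc) ?_
  · simpa [huk] using key
  · rintro r ⟨hr0, hrk⟩
    have hb : 0 < 1 + k - r := by linarith
    have h1 : 0 ≤ (1 + k - r) ^ s := by positivity
    have h2 : 0 ≤ s * (1 + k - r) ^ (s - 1) * (2 * (r * u r ^ 2)) := by positivity
    simp
    nlinarith [mul_nonneg h1 (sq_nonneg (u r + 2 * r * u' r))]

/-- A measurable function supported in a ball of `ℝ³` and dominated there by a multiple of
`‖x‖⁻²` is integrable. -/
theorem integrable_of_le_inv_norm_sq {k M : ℝ} {f : EuclideanSpace ℝ (Fin 3) → ℝ}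
    (hf : Measurable f) (hle : ∀ x, ‖x‖ ≤ k → |f x| ≤ M * (‖x‖ ^ 2)⁻¹)
    (hout : ∀ x, k < ‖x‖ → f x = 0) : Integrable f := by
  have hg : Integrable (fun x : EuclideanSpace ℝ (Fin 3) ↦
      (Set.Iic k).indicator (fun r : ℝ ↦ M * (r ^ 2)⁻¹) ‖x‖) := by
    rw [integrable_fun_norm_addHaar volume
      (f := (Set.Iic k).indicator (fun r : ℝ ↦ M * (r ^ 2)⁻¹))]
    have hc : IntegrableOn ((Set.Iic k).indicator fun _ ↦ M) (Set.Ioi (0 : ℝ)) := by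
      rw [integrableOn_indicator_iff measurableSet_Iic, Set.Iic_inter_Ioi]
      exact integrableOn_const measure_Ioc_lt_top.ne
    refine hc.congr_fun (fun r hr ↦ ?_) measurableSet_Ioi
    have hr : r ≠ 0 := (Set.mem_Ioi.1 hr).ne'
    by_cases hrk : r ≤ k
    · simp [hrk]
      field_simp
    · simp [hrk]
  refine hg.mono' hf.aestronglyMeasurable (.of_forall fun x ↦ ?_)
  by_cases hx : ‖x‖ ≤ k
  · simpa [hx] using hle x hx
  · simp [hx, hout x (not_le.1 hx)]

/-- Hardy-type inequality (2.3): for `s ≥ 0`, `k ≥ 1` and every `C¹` function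
`φ : ℝ³ → ℝ` supported in `B(k)`,
`∫ (1+k-|x|)^s φ²/|x|² ≤ 4 ∫ (1+k-|x|)^s (∂_r φ + φ/|x|)²`. -/
theorem stmt_2 (s k : ℝ) (hs : 0 ≤ s) (hk : 1 ≤ k)
    (φ : EuclideanSpace ℝ (Fin 3) → ℝ) (hφ : ContDiff ℝ 1 φ)
    (hsupp : ∀ x : EuclideanSpace ℝ (Fin 3),
      x ∉ closedBall (0 : EuclideanSpace ℝ (Fin 3)) k → φ x = 0) :
    (∫ x : EuclideanSpace ℝ (Fin 3), (1 + k - ‖x‖) ^ s * (φ x) ^ 2 / ‖x‖ ^ 2) ≤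
      4 * ∫ x : EuclideanSpace ℝ (Fin 3),
        (1 + k - ‖x‖) ^ s * (fderiv ℝ φ x (‖x‖⁻¹ • x) + φ x / ‖x‖) ^ 2 := by
  have hk0 : 0 ≤ k := by linarith
  have hφc : Continuous φ := hφ.continuous
  have hdc : Continuous (fderiv ℝ φ) := hφ.continuous_fderiv one_ne_zero
  have hout : ∀ x, k < ‖x‖ → φ x = 0 := fun x hx ↦ hsupp x (by simpa using hx)
  have hdout : ∀ x, k < ‖x‖ → fderiv ℝ φ x = 0 := fun x hx ↦ by
    have : φ =ᶠ[nhds x] fun _ ↦ 0 :=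
      Filter.mem_of_superset ((isOpen_lt continuous_const continuous_norm).mem_nhds hx) hout
    rw [this.fderiv_eq, fderiv_fun_const, Pi.zero_apply]
  have hcomp := isCompact_closedBall (0 : EuclideanSpace ℝ (Fin 3)) k
  obtain ⟨A, hA⟩ := hcomp.exists_bound_of_continuousOn hφc.continuousOn
  obtain ⟨B, hB⟩ := hcomp.exists_bound_of_continuousOn hdc.continuousOn
  have hweight : ∀ x : EuclideanSpace ℝ (Fin 3), ‖x‖ ≤ k →
      0 ≤ (1 + k - ‖x‖) ^ s ∧ (1 + k - ‖x‖) ^ s ≤ (1 + k) ^ s := fun x hx ↦ by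
    have := norm_nonneg x
    exact ⟨Real.rpow_nonneg (by linarith) _,
      Real.rpow_le_rpow (by linarith) (by linarith) hs⟩
  have hI₁ : Integrable fun x : EuclideanSpace ℝ (Fin 3) ↦
      (1 + k - ‖x‖) ^ s * (φ x) ^ 2 / ‖x‖ ^ 2 := by
    refine integrable_of_le_inv_norm_sq (k := k) (M := (1 + k) ^ s * A ^ 2) (by fun_prop)
      (fun x hx ↦ ?_) fun x hx ↦ by simp [hout x hx]
    obtain ⟨h0, h1⟩ := hweight x hx
    have hAx : φ x ^ 2 ≤ A ^ 2 := sq_le_sq' (abs_le.1 (hA x (by simpa using hx))).1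
      (abs_le.1 (hA x (by simpa using hx))).2
    rw [abs_of_nonneg (by positivity), div_eq_mul_inv]
    gcongr
  have hI₂ : Integrable fun x : EuclideanSpace ℝ (Fin 3) ↦
      (1 + k - ‖x‖) ^ s * (fderiv ℝ φ x (‖x‖⁻¹ • x) + φ x / ‖x‖) ^ 2 := by
    have hm : Measurable fun x : EuclideanSpace ℝ (Fin 3) ↦ fderiv ℝ φ x x :=
      (hdc.clm_apply continuous_id).measurable
    refine integrable_of_le_inv_norm_sq (k := k) (M := (1 + k) ^ s * (B * k + A) ^ 2)
      (by simp only [map_smul, smul_eq_mul]; fun_prop)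
      (fun x hx ↦ ?_) fun x hx ↦ by simp [hout x hx, hdout x hx]
    obtain ⟨h0, h1⟩ := hweight x hx
    have hAx := hA x (by simpa using hx)
    have hBx := hB x (by simpa using hx)
    have hd : ‖fderiv ℝ φ x x + φ x‖ ≤ B * k + A :=
      (norm_add_le _ _).trans (add_le_add (((fderiv ℝ φ x).le_opNorm x).trans
        (mul_le_mul hBx hx (norm_nonneg _) ((norm_nonneg _).trans hBx))) hAx)
    have hsq : (fderiv ℝ φ x x + φ x) ^ 2 ≤ (B * k + A) ^ 2 :=
      sq_le_sq' (abs_le.1 hd).1 (abs_le.1 hd).2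
    have heq : fderiv ℝ φ x (‖x‖⁻¹ • x) + φ x / ‖x‖ = (fderiv ℝ φ x x + φ x) * ‖x‖⁻¹ := by
      simp only [map_smul, smul_eq_mul]
      ring
    rw [abs_of_nonneg (by positivity), heq, mul_pow, inv_pow, ← mul_assoc]
    gcongr
  rw [← integral_const_mul, ← sub_nonneg, ← integral_sub (hI₂.const_mul 4) hI₁]
  refine integral_nonneg_of_forall_ray volume fun v hv ↦ ?_
  have hderiv : ∀ r : ℝ, HasDerivAt (fun r : ℝ ↦ φ (r • v)) (fderiv ℝ φ (r • v) v) r :=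
    fun r ↦ ((hφ.differentiable one_ne_zero _).hasFDerivAt.comp_hasDerivAt r
      (by simpa using (hasDerivAt_id r).smul_const v))
  have hend : φ (k • v) = 0 := by
    have hcl : IsClosed {r : ℝ | φ (r • v) = 0} := isClosed_eq (by fun_prop) continuous_const
    have hsub : Set.Ioi k ⊆ {r : ℝ | φ (r • v) = 0} := fun r hr ↦ hout _ (by
      rw [norm_smul, hv, mul_one]
      exact (Set.mem_Ioi.1 hr).trans_le (le_abs_self r))
    exact closure_minimal hsub hcl (by simp)
  have key := weighted_hardy_interval hs hk0 hderiv
    (hdc.comp (by fun_prop) |>.clm_apply continuous_const) hend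
  rw [intervalIntegral.integral_of_le hk0] at key
  refine key.trans_eq (Eq.trans ?_ (setIntegral_eq_of_subset_of_forall_sdiff_eq_zero
    measurableSet_Ioi (s := Set.Ioc 0 k) (fun r hr ↦ hr.1) ?_).symm)
  · refine setIntegral_congr_fun measurableSet_Ioc fun r hr ↦ ?_
    have hr0 : 0 < r := hr.1
    simp [norm_smul, hv, abs_of_pos hr0]
    field_simp
    ring
  · rintro r ⟨hr0, hr⟩
    have hr0 : 0 < r := hr0
    have hrk : k < ‖r • v‖ := by
      rw [norm_smul, hv, mul_one, Real.norm_of_nonneg hr0.le]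
      by_contra! hle
      exact hr ⟨hr0, hle⟩
    simp [hout _ hrk, hdout _ hrk]
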